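/- There is an absolute constant C > 0 with the following property. Let T be a finite rooted binary tree with leaf assignment χ and maximum path decomposition P_max(T); let L' be the set of supported short paths of P_max(T) and H the set of tall paths of P_max(T). Then Σ_{p ∈ L'} |H_p| · log(1 + |H_p|) ≤ C · Σ_{q ∈ H} Σ_{v ∈ q} log(1 + |H_v|). -/

import Mathlib

open scoped Classical
noncomputable section

/-- A finite rooted binary tree on vertex set `V`: every non-root vertex has a parent,
the root has none, depths are consistent (ensuring acyclicity), and each vertex has
at most two children. -/
structure RBTree (V : Type) [Fintype V] [DecidableEq V] where
  parent : V → Option V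
  root : V
  depth : V → ℕ
  parent_root : parent root = none
  root_of_parent_none : ∀ v, parent v = none → v = root
  depth_parent : ∀ v u, parent v = some u → depth v = depth u + 1
  binary : ∀ v : V, (Finset.univ.filter (fun c => parent c = some v)).card ≤ 2

namespace RBTree

variable {V : Type} [Fintype V] [DecidableEq V]

/-- The children of a vertex. -/
def children (T : RBTree V) (v : V) : Finset V :=
  Finset.univ.filter (fun c => T.parent c = some v)

/-- A leaf is a vertex with no children. -/
def IsLeaf (T : RBTree V) (v : V) : Prop := T.children v = ∅

/-- Iterated parent map. -/
def parentIter (T : RBTree V) : ℕ → V → Option V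
  | 0, v => some v
  | n + 1, v => (T.parentIter n v).bind T.parent

/-- `u` is a (weak) ancestor of `v`: `u` lies on the path from `v` to the root
(including `v` itself). -/
def Anc (T : RBTree V) (u v : V) : Prop := ∃ n, T.parentIter n v = some u

/-- `u` is a strict ancestor of `v`. -/
def StrictAnc (T : RBTree V) (u v : V) : Prop := ∃ n, 0 < n ∧ T.parentIter n v = some u

/-- `L(T_v)`: the leaves of the subtree rooted at `v`. -/
def subtreeLeaves (T : RBTree V) (v : V) : Finset V :=
  Finset.univ.filter (fun l => T.IsLeaf l ∧ T.Anc v l)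

/-- A leaf assignment `χ` assigns to each internal vertex a set of leaves containing
exactly one leaf from the subtree of each of its children (and nothing else);
leaves are assigned the empty set. -/
structure LeafAssignment (T : RBTree V) where
  χ : V → Finset V
  mem_leaf : ∀ v l, l ∈ χ v → T.IsLeaf l
  mem_desc : ∀ v l, l ∈ χ v → ∃ c ∈ T.children v, T.Anc c l
  unique_child : ∀ v, ∀ c ∈ T.children v, ∃! l, l ∈ χ v ∧ T.Anc c l

/-- The heap `H_v = {u ∈ A(v) : χ(u) ∩ L(T_v) ≠ ∅}` of a vertex `v`. -/
def heap (T : RBTree V) (A : T.LeafAssignment) (v : V) : Finset V :=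
  Finset.univ.filter (fun u => T.StrictAnc u v ∧ (A.χ u ∩ T.subtreeLeaves v).Nonempty)

/-- A leaf path: the set of vertices on a monotone path from some leaf `ℓ` up to an
ancestor `b` of `ℓ`. -/
def IsLeafPath (T : RBTree V) (p : Finset V) : Prop :=
  ∃ ℓ b, T.IsLeaf ℓ ∧ T.Anc b ℓ ∧
    p = Finset.univ.filter (fun u => T.Anc u ℓ ∧ T.Anc b u)

/-- The base `b(p)` of a path: its vertex closest to the root. -/
def base (T : RBTree V) (p : Finset V) : V :=
  if h : ∃ b, b ∈ p ∧ ∀ w ∈ p, T.Anc b w then h.choose else T.root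

/-- The leaf `ℓ(p)` of a path. -/
def pathLeaf (T : RBTree V) (p : Finset V) : V :=
  if h : ∃ l, l ∈ p ∧ ∀ w ∈ p, T.Anc w l then h.choose else T.root

/-- `H_p = H_{b(p)}`. -/
def pathHeap (T : RBTree V) (A : T.LeafAssignment) (p : Finset V) : Finset V :=
  T.heap A (T.base p)

/-- A path decomposition: a partition of the vertex set into leaf paths. -/
def IsPathDecomp (T : RBTree V) (P : Finset (Finset V)) : Prop :=
  (∀ p ∈ P, T.IsLeafPath p) ∧ (∀ v : V, ∃! p, p ∈ P ∧ v ∈ p)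

/-- `q` is a child of `p` in the shrub: the parent of `b(q)` lies on `p`. -/
def ShrubParent (T : RBTree V) (p q : Finset V) : Prop :=
  ∃ u, T.parent (T.base q) = some u ∧ u ∈ p

/-- `p` is a strict ancestor of `q` in the shrub: some vertex of `p` is a strict
ancestor of `b(q)` in `T` (and `p ≠ q`). -/
def ShrubStrictAnc (T : RBTree V) (p q : Finset V) : Prop :=
  p ≠ q ∧ ∃ u ∈ p, T.StrictAnc u (T.base q)

/-- Weak ancestor relation in the shrub. -/
def ShrubAnc (T : RBTree V) (p q : Finset V) : Prop :=
  p = q ∨ T.ShrubStrictAnc p q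

/-- A maximum path decomposition w.r.t. a leaf assignment: a path decomposition in
which each internal vertex lies on the same path as a child of maximal heap size. -/
def IsMaxPathDecomp (T : RBTree V) (A : T.LeafAssignment) (P : Finset (Finset V)) : Prop :=
  T.IsPathDecomp P ∧
    ∀ p ∈ P, ∀ v ∈ p, ∀ c ∈ T.children v, c ∈ p →
      ∀ c' ∈ T.children v, (T.heap A c').card ≤ (T.heap A c).card

/-- A path `p` is short if `|p| < sqrt(|H_p|)/100`. -/
def IsShort (T : RBTree V) (A : T.LeafAssignment) (p : Finset V) : Prop :=
  (p.card : ℝ) < Real.sqrt ((T.pathHeap A p).card) / 100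

/-- The tall support chain of a path `p`: the maximal chain of tall paths in the shrub
starting at the parent of `p` and going up. -/
def TallChain (T : RBTree V) (A : T.LeafAssignment) (P : Finset (Finset V)) (p : Finset V) :
    Finset (Finset V) :=
  P.filter (fun q => T.ShrubStrictAnc q p ∧
    ∀ r ∈ P, T.ShrubStrictAnc r p → T.ShrubAnc q r → ¬ T.IsShort A r)

/-- A short path is supported if at least `|H_p|/100` of the vertices of `H_p` lie on
paths of its tall support chain. -/
def IsSupported (T : RBTree V) (A : T.LeafAssignment) (P : Finset (Finset V))
    (p : Finset V) : Prop :=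
  ((T.pathHeap A p).card : ℝ) / 100 ≤
    (((T.pathHeap A p).filter (fun v => ∃ q ∈ T.TallChain A P p, v ∈ q)).card : ℝ)

/-- The reduced heap `H̃_p`: vertices of `H_p` not lying on the tall support chain. -/
def redHeap (T : RBTree V) (A : T.LeafAssignment) (P : Finset (Finset V))
    (p : Finset V) : Finset V :=
  (T.pathHeap A p).filter (fun v => ∀ q ∈ T.TallChain A P p, v ∉ q)

/-- `q` is the parent of the unsupported short path `p` in the shrub forest of
unsupported short paths: `q` is the first short path on the chain of strict shrub
ancestors of `p`. -/
def ForestParent (T : RBTree V) (A : T.LeafAssignment) (P : Finset (Finset V))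
    (q p : Finset V) : Prop :=
  q ∈ P ∧ p ∈ P ∧ T.IsShort A q ∧ T.IsShort A p ∧ ¬ T.IsSupported A P p ∧
    T.ShrubStrictAnc q p ∧
    ∀ r ∈ P, T.ShrubStrictAnc r p → T.ShrubStrictAnc q r → ¬ T.IsShort A r

/-- `U` is the connected component of the shrub forest of unsupported short paths
rooted at the supported short path `r`. -/
def IsComponent (T : RBTree V) (A : T.LeafAssignment) (P : Finset (Finset V))
    (U : Finset (Finset V)) (r : Finset V) : Prop :=
  U ⊆ P ∧ r ∈ U ∧ T.IsShort A r ∧ T.IsSupported A P r ∧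
    (∀ p ∈ U, T.IsShort A p) ∧
    (∀ p ∈ U, p ≠ r → ¬ T.IsSupported A P p) ∧
    (∀ p ∈ U, p ≠ r → ∃ q ∈ U, T.ForestParent A P q p) ∧
    (∀ q ∈ U, ∀ p ∈ P, T.ForestParent A P q p → p ∈ U)

/-- `q` lies in the subtree of the shrub forest rooted at `p`. -/
def ForestDesc (T : RBTree V) (A : T.LeafAssignment) (P : Finset (Finset V))
    (p q : Finset V) : Prop :=
  Relation.ReflTransGen (fun a b => T.ForestParent A P a b) p q

/-- `U_p`: the nodes of `U` in the subtree of the shrub forest rooted at `p`. -/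
def usub (T : RBTree V) (A : T.LeafAssignment) (P : Finset (Finset V))
    (U : Finset (Finset V)) (p : Finset V) : Finset (Finset V) :=
  U.filter (fun q => T.ForestDesc A P p q)

/-- The children of `p` in the shrub forest (within `U`). -/
def forestChildren (T : RBTree V) (A : T.LeafAssignment) (P : Finset (Finset V))
    (U : Finset (Finset V)) (p : Finset V) : Finset (Finset V) :=
  U.filter (fun q => T.ForestParent A P p q)

/-- The residue `R_p = |H̃_p| − Σ_{q child of p} |H̃_q|`. -/
def residue (T : RBTree V) (A : T.LeafAssignment) (P : Finset (Finset V))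
    (U : Finset (Finset V)) (p : Finset V) : ℤ :=
  ((T.redHeap A P p).card : ℤ) -
    ∑ q ∈ T.forestChildren A P U p, ((T.redHeap A P q).card : ℤ)

/-- `R⁺_p = max(R_p, 0)`. -/
def resPlus (T : RBTree V) (A : T.LeafAssignment) (P : Finset (Finset V))
    (U : Finset (Finset V)) (p : Finset V) : ℤ :=
  max (T.residue A P U p) 0

/-- The weight `W_p = Σ_{q ∈ U_p} R⁺_q`. -/
def weight (T : RBTree V) (A : T.LeafAssignment) (P : Finset (Finset V))
    (U : Finset (Finset V)) (p : Finset V) : ℤ :=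
  ∑ q ∈ T.usub A P U p, T.resPlus A P U q

end RBTree

namespace RBTree

theorem log_one_add_natCast_nonneg (n : ℕ) : 0 ≤ Real.log (1 + (n : ℝ)) :=
  Real.log_nonneg (by linarith [(Nat.cast_nonneg n : (0 : ℝ) ≤ n)])

variable {V : Type} [Fintype V] [DecidableEq V] {T : RBTree V}

theorem parentIter_add (m n : ℕ) (v : V) :
    T.parentIter (m + n) v = (T.parentIter n v).bind (T.parentIter m) := by
  induction m with
  | zero => cases h : T.parentIter n v <;> simp [parentIter, h]
  | succ m ih =>
    rw [Nat.succ_add, parentIter, ih]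
    cases T.parentIter n v <;> simp [parentIter]

theorem Anc.trans {u v w : V} (h₁ : T.Anc u v) (h₂ : T.Anc v w) : T.Anc u w := by
  obtain ⟨m, hm⟩ := h₁
  obtain ⟨n, hn⟩ := h₂
  exact ⟨m + n, by simp [parentIter_add, hn, hm]⟩

theorem StrictAnc.anc {u v : V} (h : T.StrictAnc u v) : T.Anc u v :=
  let ⟨n, _, hn⟩ := h
  ⟨n, hn⟩

theorem Anc.eq_or_strictAnc {u v : V} (h : T.Anc u v) : u = v ∨ T.StrictAnc u v := by
  obtain ⟨n, hn⟩ := h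
  rcases Nat.eq_zero_or_pos n with rfl | hpos
  · left
    simpa [parentIter, eq_comm] using hn
  · exact Or.inr ⟨n, hpos, hn⟩

theorem depth_of_parentIter {n : ℕ} {u v : V} (h : T.parentIter n v = some u) :
    T.depth v = T.depth u + n := by
  induction n generalizing u with
  | zero =>
    have : v = u := by simpa [parentIter] using h
    simp [this]
  | succ n ih =>
    obtain ⟨w, hw, hwu⟩ := Option.bind_eq_some_iff.mp h
    rw [ih hw, T.depth_parent w u hwu]
    ring

theorem StrictAnc.depth_lt {u v : V} (h : T.StrictAnc u v) : T.depth u < T.depth v := by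
  obtain ⟨n, hpos, hn⟩ := h
  have := depth_of_parentIter hn
  omega

/-- Any two ancestors of a vertex are comparable. -/
theorem Anc.total {u v w : V} (hu : T.Anc u w) (hv : T.Anc v w) : T.Anc u v ∨ T.Anc v u := by
  obtain ⟨m, hm⟩ := hu
  obtain ⟨n, hn⟩ := hv
  rcases le_total m n with h | h
  · obtain ⟨k, rfl⟩ := Nat.exists_eq_add_of_le' h
    exact Or.inr ⟨k, by simpa [parentIter_add, hm] using hn⟩
  · obtain ⟨k, rfl⟩ := Nat.exists_eq_add_of_le' h
    exact Or.inl ⟨k, by simpa [parentIter_add, hn] using hm⟩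

theorem IsLeafPath.base_mem {p : Finset V} (hp : T.IsLeafPath p) : T.base p ∈ p := by
  have h : ∃ b, b ∈ p ∧ ∀ w ∈ p, T.Anc b w := by
    obtain ⟨l, b, -, hbl, rfl⟩ := hp
    refine ⟨b, by simpa using ⟨hbl, 0, rfl⟩, fun w hw => ?_⟩
    simp only [Finset.mem_filter] at hw
    exact hw.2.2
  rw [base, dif_pos h]
  exact h.choose_spec.1

variable {A : T.LeafAssignment} {P : Finset (Finset V)}

theorem card_leafAssignment_le_two (v : V) : (A.χ v).card ≤ 2 := by
  choose! c hc hcl using fun l => A.mem_desc v l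
  refine (Finset.card_le_card_of_injOn c hc ?_).trans (T.binary v)
  intro l hl l' hl' h
  exact (A.unique_child v (c l) (hc l hl)).unique ⟨hl, hcl l hl⟩ ⟨hl', h ▸ hcl l' hl'⟩

/-- Heaps are inherited upwards: an element of the heap of `w` strictly above an ancestor `v` of
`w` belongs to the heap of `v`. -/
theorem mem_heap_of_anc {u v w : V} (hu : u ∈ T.heap A w) (huv : T.StrictAnc u v)
    (hvw : T.Anc v w) : u ∈ T.heap A v := by
  simp only [heap, Finset.mem_filter, Finset.mem_univ, true_and] at hu ⊢
  obtain ⟨-, l, hl⟩ := hu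
  refine ⟨huv, l, ?_⟩
  simp only [subtreeLeaves, Finset.mem_inter, Finset.mem_filter, Finset.mem_univ,
    true_and] at hl ⊢
  exact ⟨hl.1, hl.2.1, hvw.trans hl.2.2⟩

/-- Fewer than `t + 1` elements of a heap have a heap of size less than `t`. -/
theorem card_filter_heap_lt {w : V} {S : Finset V} (hS : S ⊆ T.heap A w) {t : ℝ} (ht : 0 ≤ t) :
    ((S.filter fun x => ((T.heap A x).card : ℝ) < t).card : ℝ) < t + 1 := by
  set B := S.filter fun x => ((T.heap A x).card : ℝ) < t with hB
  rcases B.eq_empty_or_nonempty with h | h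
  · simp only [h, Finset.card_empty, Nat.cast_zero]
    linarith
  obtain ⟨x, hx, hmax⟩ := B.exists_max_image T.depth h
  have anc : ∀ y ∈ B, y ∈ T.heap A w ∧ T.Anc y w := fun y hy => by
    have hyw := hS (Finset.mem_filter.mp hy).1
    exact ⟨hyw, (Finset.mem_filter.mp hyw).2.1.anc⟩
  have hsub : B.erase x ⊆ T.heap A x := by
    intro y hy
    obtain ⟨hne, hyB⟩ := Finset.mem_erase.mp hy
    refine mem_heap_of_anc (anc y hyB).1 ?_ (anc x hx).2
    rcases (anc y hyB).2.total (anc x hx).2 with h | h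
    · exact h.eq_or_strictAnc.resolve_left hne
    · exact absurd (h.eq_or_strictAnc.resolve_left hne.symm).depth_lt (hmax y hyB).not_gt
  have hcard := Finset.card_le_card hsub
  have hlt := (Finset.mem_filter.mp hx).2
  have hcard' : (B.card : ℝ) ≤ (T.heap A x).card + 1 := by
    rw [← Finset.card_erase_add_one hx]
    exact_mod_cast Nat.succ_le_succ hcard
  linarith

/-- The elements of the heap of `p` lying on its tall support chain. -/
def supportHeap (T : RBTree V) (A : T.LeafAssignment) (P : Finset (Finset V)) (p : Finset V) :
    Finset V :=
  (T.pathHeap A p).filter (fun v => ∃ q ∈ T.TallChain A P p, v ∈ q)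

theorem not_isShort_of_mem_tallChain {p q : Finset V} (h : q ∈ T.TallChain A P p) :
    ¬ T.IsShort A q := by
  obtain ⟨hq, hqp, hr⟩ := Finset.mem_filter.mp h
  exact hr q hq hqp (Or.inl rfl)

theorem IsShort.lt_card_pathHeap {p : Finset V} (h : T.IsShort A p) (hp : p.Nonempty) :
    10000 < ((T.pathHeap A p).card : ℝ) := by
  have h1 : (1 : ℝ) ≤ p.card := by exact_mod_cast hp.card_pos
  have h2 : (100 : ℝ) < √((T.pathHeap A p).card) := by
    unfold IsShort at h
    linarith
  rw [Real.lt_sqrt (by norm_num)] at h2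
  linarith

theorem log_one_add_le_four_mul {h : ℝ} (hh : 10000 < h) :
    Real.log (1 + h) ≤ 4 * Real.log (1 + h / 200) := by
  have : Real.log ((1 + h / 200) ^ 4) = 4 * Real.log (1 + h / 200) := by
    rw [Real.log_pow]
    norm_num
  rw [← this]
  apply Real.log_le_log (by linarith)
  obtain ⟨t, rfl⟩ : ∃ t, h = 200 * t := ⟨h / 200, by ring⟩
  have ht : 50 < t := by linarith
  have h2 : 51 ^ 2 ≤ (1 + t) ^ 2 := pow_le_pow_left₀ (by norm_num) (by linarith) 2
  have e : (1 + 200 * t / 200) ^ 4 = (1 + t) ^ 2 * (1 + t) ^ 2 := by ring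
  rw [e]
  nlinarith

/-- A supported short path is paid for by the elements of its heap on its tall support chain. -/
theorem card_mul_log_le_sum_supportHeap {p : Finset V} (hne : p.Nonempty) (hs : T.IsShort A p)
    (hsup : T.IsSupported A P p) :
    ((T.pathHeap A p).card : ℝ) * Real.log (1 + ((T.pathHeap A p).card : ℝ)) ≤
      1600 * ∑ x ∈ T.supportHeap A P p, Real.log (1 + ((T.heap A x).card : ℝ)) := by
  have hbig := hs.lt_card_pathHeap hne
  change _ ≤ ((T.supportHeap A P p).card : ℝ) at hsup
  set h : ℝ := ((T.pathHeap A p).card : ℝ)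
  set S := T.supportHeap A P p with hS
  have hbad := card_filter_heap_lt (A := A) (w := T.base p) (S := S)
    (Finset.filter_subset _ _) (t := h / 200) (by linarith)
  set G := S.filter fun x => ¬ ((T.heap A x).card : ℝ) < h / 200 with hG
  have hsplit : ((S.filter fun x => ((T.heap A x).card : ℝ) < h / 200).card : ℝ) + G.card
      = S.card := by
    exact_mod_cast Finset.card_filter_add_card_filter_not _
  have hGcard : h / 400 ≤ G.card := by linarith
  have hlog := log_one_add_le_four_mul hbig
  have hpos : 0 ≤ Real.log (1 + h / 200) := Real.log_nonneg (by linarith)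
  have hsum : (G.card : ℝ) * Real.log (1 + h / 200) ≤
      ∑ x ∈ S, Real.log (1 + ((T.heap A x).card : ℝ)) := by
    rw [← nsmul_eq_mul]
    refine (Finset.card_nsmul_le_sum G (fun x => Real.log (1 + ((T.heap A x).card : ℝ))) _
      fun x hx => ?_).trans (Finset.sum_le_sum_of_subset_of_nonneg (Finset.filter_subset _ _)
        fun x _ _ => log_one_add_natCast_nonneg _)
    have := not_lt.mp (Finset.mem_filter.mp hx).2
    exact Real.log_le_log (by linarith) (by linarith)
  calc h * Real.log (1 + h) ≤ h * (4 * Real.log (1 + h / 200)) :=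
        mul_le_mul_of_nonneg_left hlog (by linarith)
    _ = 1600 * (h / 400 * Real.log (1 + h / 200)) := by ring
    _ ≤ 1600 * (G.card * Real.log (1 + h / 200)) := by gcongr
    _ ≤ _ := by gcongr

/-- If the heaps of two short paths meet `x` in a common leaf and `x` supports the second, then
the base of the first is not strictly above the base of the second. -/
theorem not_strictAnc_base {p p' : Finset V} {x : V} (hp : p ∈ P) (hpp : p ≠ p')
    (hb : T.base p ∈ p) (hs : T.IsShort A p) (hx : T.StrictAnc x (T.base p))
    (hx' : x ∈ T.supportHeap A P p') : ¬ T.StrictAnc (T.base p) (T.base p') := by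
  intro h
  obtain ⟨-, q, hq, hxq⟩ := Finset.mem_filter.mp hx'
  have hqp : q ≠ p := by
    rintro rfl
    exact not_isShort_of_mem_tallChain hq hs
  exact (Finset.mem_filter.mp hq).2.2 p hp ⟨hpp, _, hb, h⟩ (Or.inr ⟨hqp, x, hxq, hx⟩) hs

/-- A vertex supports at most two short paths. -/
theorem card_filter_mem_supportHeap_le_two (hP : T.IsPathDecomp P) (x : V) :
    (P.filter fun p => T.IsShort A p ∧ x ∈ T.supportHeap A P p).card ≤ 2 := by
  have key : ∀ p ∈ P.filter (fun p => T.IsShort A p ∧ x ∈ T.supportHeap A P p),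
      T.StrictAnc x (T.base p) ∧ ∃ l ∈ A.χ x, T.Anc (T.base p) l := by
    intro p hp
    obtain ⟨hx, l, hl⟩ := (Finset.mem_filter.mp
      (Finset.mem_filter.mp (Finset.mem_filter.mp hp).2.2).1).2
    obtain ⟨hl, hl'⟩ := Finset.mem_inter.mp hl
    exact ⟨hx, l, hl, (Finset.mem_filter.mp hl').2.2⟩
  have : Nonempty V := ⟨x⟩
  choose! hstrict l hl hanc using key
  refine (Finset.card_le_card_of_injOn l hl ?_).trans (card_leafAssignment_le_two x)
  intro p hp p' hp' hll
  have h₁ := hanc p hp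
  have h₂ := hanc p' hp'
  rw [hll] at h₁
  have hx := hstrict p hp
  have hx' := hstrict p' hp'
  obtain ⟨hpP, hs, hsup⟩ := Finset.mem_filter.mp hp
  obtain ⟨hpP', hs', hsup'⟩ := Finset.mem_filter.mp hp'
  have hb := (hP.1 p hpP).base_mem
  have hb' := (hP.1 p' hpP').base_mem
  by_contra hne
  have hbne : T.base p ≠ T.base p' := fun h =>
    hne ((hP.2 (T.base p)).unique ⟨hpP, hb⟩ ⟨hpP', h ▸ hb'⟩)
  rcases h₁.total h₂ with h | h
  · exact not_strictAnc_base hpP hne hb hs hx hsup' (h.eq_or_strictAnc.resolve_left hbne)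
  · exact not_strictAnc_base hpP' (Ne.symm hne) hb' hs' hx' hsup
      (h.eq_or_strictAnc.resolve_left hbne.symm)

end RBTree

open RBTree in
/-- there is an absolute constant `C > 0` such that, for `L'` the supported
short paths and `H` the tall paths of a maximum path decomposition,
`Σ_{p ∈ L'} |H_p|·log(1+|H_p|) ≤ C · Σ_{q ∈ H} Σ_{v ∈ q} log(1+|H_v|)`. -/
theorem supported_short_charged_to_tall :
    ∃ C : ℝ, 0 < C ∧
      ∀ (V : Type) [Fintype V] [DecidableEq V] (T : RBTree V) (A : T.LeafAssignment)
        (P : Finset (Finset V)), T.IsMaxPathDecomp A P →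
        ∑ p ∈ P.filter (fun p => T.IsShort A p ∧ T.IsSupported A P p),
            ((T.pathHeap A p).card : ℝ) * Real.log (1 + ((T.pathHeap A p).card : ℝ)) ≤
          C * ∑ q ∈ P.filter (fun q => ¬ T.IsShort A q),
                ∑ v ∈ q, Real.log (1 + ((T.heap A v).card : ℝ)) := by
  refine ⟨3200, by norm_num, fun V _ _ T A P hmax => ?_⟩
  have hP := hmax.1
  set f : V → ℝ := fun v => Real.log (1 + ((T.heap A v).card : ℝ)) with hf
  have hf0 : ∀ v, 0 ≤ f v := fun v => log_one_add_natCast_nonneg _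
  set L := P.filter (fun p => T.IsShort A p ∧ T.IsSupported A P p) with hL
  set tall := P.filter (fun q => ¬ T.IsShort A q) with htall
  have hdisj : (tall : Set (Finset V)).PairwiseDisjoint id := by
    intro q hq q' hq' hne
    refine Finset.disjoint_left.mpr fun v hv hv' => hne ?_
    exact (hP.2 v).unique ⟨(Finset.mem_filter.mp hq).1, hv⟩ ⟨(Finset.mem_filter.mp hq').1, hv'⟩
  have hsum : ∑ q ∈ tall, ∑ v ∈ q, f v = ∑ v ∈ tall.biUnion id, f v :=
    (Finset.sum_biUnion hdisj).symm
  have hsub : ∀ p, T.supportHeap A P p ⊆ tall.biUnion id := by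
    intro p x hx
    obtain ⟨-, q, hq, hxq⟩ := Finset.mem_filter.mp hx
    exact Finset.mem_biUnion.mpr ⟨q, Finset.mem_filter.mpr
      ⟨(Finset.mem_filter.mp hq).1, not_isShort_of_mem_tallChain hq⟩, hxq⟩
  have hcount : ∀ x, ((L.filter fun p => x ∈ T.supportHeap A P p).card : ℝ) ≤ 2 := by
    intro x
    norm_cast
    refine (Finset.card_le_card ?_).trans (card_filter_mem_supportHeap_le_two (A := A) hP x)
    intro p hp
    simp only [hL, Finset.mem_filter] at hp ⊢
    exact ⟨hp.1.1, hp.1.2.1, hp.2⟩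
  calc _ ≤ ∑ p ∈ L, 1600 * ∑ x ∈ T.supportHeap A P p, f x := by
        refine Finset.sum_le_sum fun p hp => ?_
        obtain ⟨hpP, hs, hsup⟩ := Finset.mem_filter.mp hp
        exact card_mul_log_le_sum_supportHeap ⟨_, (hP.1 p hpP).base_mem⟩ hs hsup
    _ = 1600 * ∑ p ∈ L, ∑ x ∈ T.supportHeap A P p, f x := by rw [Finset.mul_sum]
    _ = 1600 * ∑ x ∈ tall.biUnion id, ∑ p ∈ L with x ∈ T.supportHeap A P p, f x := by
        congr 1
        refine Finset.sum_comm' fun p x => ?_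
        simp only [Finset.mem_filter]
        exact ⟨fun h => ⟨⟨h.1, h.2⟩, hsub p h.2⟩, fun h => h.1⟩
    _ ≤ 1600 * ∑ x ∈ tall.biUnion id, 2 * f x := by
        gcongr with x
        rw [Finset.sum_const, nsmul_eq_mul]
        exact mul_le_mul_of_nonneg_right (hcount x) (hf0 x)
    _ = 3200 * ∑ q ∈ tall, ∑ v ∈ q, f v := by
        rw [hsum, ← Finset.mul_sum]
        ring
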